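/- arXiv:1208.3784 — 4 statements merged into one kernel-verified Lean document; each statement's English description precedes it below -/
import Mathlib

section
/- Let ℋ be a complex Hilbert space, let U be a unitary operator on ℋ, let A, F, G be bounded self-adjoint operators on ℋ, and assume AU − UA = UF + GU. For n ≥ 1 define Aₙ := (1/n) Σ_{k=0}^{n−1} U^{−k} A U^{k}, Fₙ := (1/n) Σ_{k=0}^{n−1} U^{−k} F U^{k} and Gₙ := (1/n) Σ_{k=0}^{n−1} U^{−k} G U^{k}. Then Aₙ, Fₙ, Gₙ are bounded self-adjoint operators and U*(AₙU − UAₙ) = Fₙ + U* Gₙ U. -/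
theorem stmt3_sa {H : Type*} [NormedAddCommGroup H] [InnerProductSpace ℂ H] [CompleteSpace H]
    (U A : H →L[ℂ] H) (hA : IsSelfAdjoint A) (n : ℕ) :
    IsSelfAdjoint ((n : ℂ)⁻¹ • ∑ k ∈ Finset.range n, (star U) ^ k * A * U ^ k) := by
  rw [isSelfAdjoint_iff, star_smul, star_sum]
  congr 1
  · simp
  · refine Finset.sum_congr rfl fun k _ => ?_
    simp [star_mul, star_pow, hA.star_eq, mul_assoc]

theorem stmt3_conj {R : Type*} [Ring R] (V U A : R) (k : ℕ) :
    V * (V ^ k * A * U ^ k) * U = V ^ k * (V * A * U) * U ^ k := by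
  have h1 : V * V ^ k = V ^ k * V := (pow_succ' V k).symm.trans (pow_succ V k)
  have h2 : U ^ k * U = U * U ^ k := (pow_succ U k).symm.trans (pow_succ' U k)
  calc V * (V ^ k * A * U ^ k) * U = (V * V ^ k) * A * (U ^ k * U) := by simp only [mul_assoc]
    _ = _ := by rw [h1, h2]; simp only [mul_assoc]

/-- Let `U` be unitary and `A, F, G` bounded self-adjoint operators on a
complex Hilbert space with `AU - UA = UF + GU`. For `n ≥ 1` the averaged operators
`Aₙ := (1/n) ∑_{k<n} U^{-k} A U^k`, `Fₙ`, `Gₙ` (defined analogously) are bounded self-adjoint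
and satisfy `U* (Aₙ U - U Aₙ) = Fₙ + U* Gₙ U`. -/
theorem stmt3 {H : Type*} [NormedAddCommGroup H] [InnerProductSpace ℂ H] [CompleteSpace H]
    (U A F G : H →L[ℂ] H) (hU : U ∈ unitary (H →L[ℂ] H))
    (hA : IsSelfAdjoint A) (hF : IsSelfAdjoint F) (hG : IsSelfAdjoint G)
    (hcomm : A * U - U * A = U * F + G * U) (n : ℕ) (hn : 1 ≤ n) :
    IsSelfAdjoint ((n : ℂ)⁻¹ • ∑ k ∈ Finset.range n, (star U) ^ k * A * U ^ k) ∧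
    IsSelfAdjoint ((n : ℂ)⁻¹ • ∑ k ∈ Finset.range n, (star U) ^ k * F * U ^ k) ∧
    IsSelfAdjoint ((n : ℂ)⁻¹ • ∑ k ∈ Finset.range n, (star U) ^ k * G * U ^ k) ∧
    star U * (((n : ℂ)⁻¹ • ∑ k ∈ Finset.range n, (star U) ^ k * A * U ^ k) * U
        - U * ((n : ℂ)⁻¹ • ∑ k ∈ Finset.range n, (star U) ^ k * A * U ^ k))
      = ((n : ℂ)⁻¹ • ∑ k ∈ Finset.range n, (star U) ^ k * F * U ^ k)
        + star U * ((n : ℂ)⁻¹ • ∑ k ∈ Finset.range n, (star U) ^ k * G * U ^ k) * U := by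
  refine ⟨stmt3_sa U A hA n, stmt3_sa U F hF n, stmt3_sa U G hG n, ?_⟩
  have hVU : star U * U = 1 := Unitary.star_mul_self_of_mem hU
  have key : star U * A * U = A + F + star U * G * U := by
    have h := congrArg (fun X => star U * X) hcomm
    simp only [mul_sub, mul_add, ← mul_assoc, hVU, one_mul] at h
    rw [sub_eq_iff_eq_add] at h
    rw [h]; abel
  rw [mul_sub, ← mul_assoc, ← mul_assoc, hVU, one_mul]
  simp only [mul_smul_comm, smul_mul_assoc, Finset.mul_sum, Finset.sum_mul]
  rw [← smul_sub, ← smul_add, ← Finset.sum_sub_distrib, ← Finset.sum_add_distrib]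
  congr 1
  refine Finset.sum_congr rfl fun k _ => ?_
  rw [stmt3_conj, stmt3_conj, key]
  simp only [mul_add, add_mul]
  abel
end

section
/- Let X be a compact metric space, let T : X → X be a homeomorphism preserving a Borel probability measure μ which is the unique T-invariant Borel probability measure on X (T uniquely ergodic), and let U_T be the Koopman operator on L²(X,μ) given by U_T φ = φ∘T. Let f, g : X → ℝ be continuous with ∫_X (f+g) dμ > 0, and for n ≥ 1 set f_n := (1/n) Σ_{k=0}^{n−1} f∘T^{−k} and g_n := (1/n) Σ_{k=0}^{n−1} g∘T^{−k}. Then there exist a > 0 and N ∈ ℕ such that for all n ≥ N and all φ ∈ L²(X,μ): ⟨φ, f_n·φ⟩ + ⟨U_T φ, g_n·(U_T φ)⟩ ≥ a‖φ‖², i.e., the self-adjoint operator M_{f_n} + U_T* M_{g_n} U_T is bounded below by a·1. -/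
open MeasureTheory Filter Topology BoundedContinuousFunction

noncomputable def empM {X : Type*} [MeasurableSpace X] (S : X → X) (n : ℕ) (x : X) : Measure X :=
  (n : ENNReal)⁻¹ • ∑ k ∈ Finset.range n, Measure.dirac (S^[k] x)

theorem empM_prob {X : Type*} [MeasurableSpace X] (S : X → X) (n : ℕ) (hn : n ≠ 0) (x : X) :
    IsProbabilityMeasure (empM S n x) := by
  constructor
  simp only [empM, Measure.smul_apply, Measure.finsetSum_apply, measure_univ, Finset.sum_const,
    Finset.card_range, smul_eq_mul, nsmul_eq_mul, mul_one]
  exact ENNReal.inv_mul_cancel (by exact_mod_cast hn) (by simp)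

theorem empM_int {X : Type*} [TopologicalSpace X] [CompactSpace X]
    [MeasurableSpace X] [BorelSpace X]
    (S : X → X) (n : ℕ) (x : X) (u : X → ℝ) (hu : Continuous u) :
    ∫ y, u y ∂(empM S n x) = (n : ℝ)⁻¹ * ∑ k ∈ Finset.range n, u (S^[k] x) := by
  have hm : StronglyMeasurable u := hu.measurable.stronglyMeasurable
  rw [empM, integral_smul_measure, integral_finset_sum_measure]
  · simp [integral_dirac' _ _ hm]
  · intro i _
    exact integrable_dirac' hm (by simp)

theorem key {X : Type*} [MetricSpace X] [CompactSpace X] [MeasurableSpace X] [BorelSpace X]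
    (μ : Measure X) [IsProbabilityMeasure μ] (S : X → X) (hS : Continuous S)
    (huniq : ∀ ν : Measure X, IsProbabilityMeasure ν → MeasurePreserving S ν ν → ν = μ)
    (h : X → ℝ) (hh : Continuous h) (a : ℝ) (ha : a < ∫ x, h x ∂μ) :
    ∃ N : ℕ, 1 ≤ N ∧ ∀ n ≥ N, ∀ x, a ≤ (n : ℝ)⁻¹ * ∑ k ∈ Finset.range n, h (S^[k] x) := by
  by_contra hcon
  push Not at hcon
  choose n hn x hx using fun j : ℕ => hcon (j+1) (by omega)
  have hn0 : ∀ j, n j ≠ 0 := fun j => by have := hn j; omega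
  let P : ℕ → ProbabilityMeasure X := fun j => ⟨empM S (n j) (x j), empM_prob S _ (hn0 j) _⟩
  let F : Ultrafilter ℕ := Ultrafilter.of atTop
  have hF : (F : Filter ℕ) ≤ atTop := Ultrafilter.of_le _
  obtain ⟨ν, -, hν⟩ := (isCompact_univ (X := ProbabilityMeasure X)).ultrafilter_le_nhds
    (F.map P) (by simp)
  have hν : Tendsto P F (𝓝 ν) := hν
  rw [ProbabilityMeasure.tendsto_iff_forall_integral_tendsto] at hν
  have hlim : ∀ u : X → ℝ, Continuous u → Tendsto
      (fun j => ((n j : ℕ) : ℝ)⁻¹ * ∑ k ∈ Finset.range (n j), u (S^[k] (x j))) F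
      (𝓝 (∫ y, u y ∂(ν : Measure X))) := by
    intro u hu
    have := hν (BoundedContinuousFunction.mkOfCompact ⟨u, hu⟩)
    refine this.congr fun j => ?_
    exact empM_int S (n j) (x j) u hu
  have hnt : Tendsto (fun j => ((n j : ℕ) : ℝ)⁻¹) F (𝓝 0) := by
    refine Tendsto.mono_left ?_ hF
    refine tendsto_inv_atTop_zero.comp (tendsto_natCast_atTop_atTop.comp ?_)
    exact tendsto_atTop_mono (fun j => (Nat.le_succ j).trans (hn j)) tendsto_id
  have hinv : (ν : Measure X).map S = ν := by
    haveI : IsProbabilityMeasure ((ν : Measure X).map S) :=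
      Measure.isProbabilityMeasure_map hS.aemeasurable
    refine ext_of_forall_integral_eq_of_IsFiniteMeasure fun u => ?_
    rw [integral_map hS.aemeasurable u.continuous.aestronglyMeasurable]
    have h1 := hlim (fun y => u (S y)) (u.continuous.comp hS)
    have h2 := hlim u u.continuous
    have h3 := h1.sub h2
    have h4 : Tendsto (fun j => ((n j : ℕ) : ℝ)⁻¹ * (u (S^[n j] (x j)) - u (x j))) F (𝓝 0) := by
      refine squeeze_zero_norm (a := fun j => ((n j : ℕ) : ℝ)⁻¹ * (2 * ‖u‖)) (fun j => ?_) ?_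
      · rw [norm_mul, norm_inv, Real.norm_natCast]
        gcongr
        have e1 := u.norm_coe_le_norm (S^[n j] (x j))
        have e2 := u.norm_coe_le_norm (x j)
        have e3 := norm_sub_le (u (S^[n j] (x j))) (u (x j))
        linarith
      · simpa using hnt.mul_const (2 * ‖u‖)
    have h5 := tendsto_nhds_unique (h3.congr fun j => ?_) h4
    · linarith
    · rw [← mul_sub, ← Finset.sum_sub_distrib]
      congr 1
      refine Eq.trans ?_ (Finset.sum_range_sub (fun k => u (S^[k] (x j))) (n j))
      refine Finset.sum_congr rfl fun k _ => ?_
      rw [Function.iterate_succ_apply']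
  have hνμ := huniq ν inferInstance ⟨hS.measurable, hinv⟩
  have := le_of_tendsto (hlim h hh) (Eventually.of_forall fun j => (hx j).le)
  rw [hνμ] at this
  linarith

/-- Let `T` be a uniquely ergodic measure-preserving homeomorphism of a
compact metric space `X` with unique invariant Borel probability measure `μ`, and let
`U_T φ = φ ∘ T` be the Koopman operator on `L²(X,μ)`. If `f, g : X → ℝ` are continuous with
`∫ (f+g) dμ > 0`, and `f_n := (1/n) ∑_{k<n} f ∘ T^{-k}`, `g_n := (1/n) ∑_{k<n} g ∘ T^{-k}`,
then there are `a > 0` and `N` such that for all `n ≥ N` and all `φ ∈ L²(X,μ)`: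
`⟨φ, f_n φ⟩ + ⟨U_T φ, g_n (U_T φ)⟩ ≥ a ‖φ‖²`, the quadratic forms being written as
integrals (`⟨φ, h φ⟩ = ∫ h(x) ‖φ(x)‖² dμ(x)` for real `h`, and `(U_T φ)(x) = φ(T x)`). -/
theorem stmt6 {X : Type*} [MetricSpace X] [CompactSpace X] [MeasurableSpace X] [BorelSpace X]
    (μ : Measure X) [IsProbabilityMeasure μ]
    (T : X ≃ₜ X) (hT : MeasurePreserving (⇑T) μ μ)
    (huniq : ∀ ν : Measure X, IsProbabilityMeasure ν → MeasurePreserving (⇑T) ν ν → ν = μ)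
    (f g : X → ℝ) (hf : Continuous f) (hg : Continuous g)
    (hpos : 0 < ∫ x, (f x + g x) ∂μ) :
    ∃ a > (0:ℝ), ∃ N : ℕ, ∀ n ≥ N, ∀ φ : Lp ℂ 2 μ,
      a * ‖φ‖ ^ 2 ≤
        (∫ x, ((n : ℝ)⁻¹ * ∑ k ∈ Finset.range n, f ((⇑T.symm)^[k] x)) * ‖(φ : X → ℂ) x‖ ^ 2 ∂μ)
        + ∫ x, ((n : ℝ)⁻¹ * ∑ k ∈ Finset.range n, g ((⇑T.symm)^[k] x))
            * ‖(φ : X → ℂ) (T x)‖ ^ 2 ∂μ := by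
  have hTs : MeasurePreserving (⇑T.symm) μ μ := hT.symm T.toMeasurableEquiv
  have hSc : Continuous T.symm := T.symm.continuous
  have hint : ∀ u : X → ℝ, Continuous u → Integrable u μ := fun u hu =>
    hu.integrable_of_hasCompactSupport (HasCompactSupport.of_compactSpace u)
  have hI : ∫ x, (f x + g (T.symm x)) ∂μ = ∫ x, (f x + g x) ∂μ := by
    rw [integral_add (hint f hf) (hint (fun x => g (T.symm x)) (hg.comp hSc)), integral_add (hint f hf) (hint g hg),
      hTs.integral_comp T.symm.toMeasurableEquiv.measurableEmbedding g]
  obtain ⟨N, hN, hk⟩ := key μ T.symm hSc (fun ν h1 h2 => huniq ν h1 (h2.symm T.symm.toMeasurableEquiv))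
    (fun x => f x + g (T.symm x)) (hf.add (hg.comp hSc))
    ((∫ x, (f x + g x) ∂μ) / 2) (by rw [hI]; linarith)
  refine ⟨_, half_pos hpos, N, fun n hn φ => ?_⟩
  have hφ : Integrable (fun x => ‖(φ : X → ℂ) x‖ ^ 2) μ := (Lp.memLp φ).integrable_norm_pow (by simp)
  have hnorm : ‖φ‖ ^ 2 = ∫ x, ‖(φ : X → ℂ) x‖ ^ 2 ∂μ := by
    have := congrArg Complex.re (L2.inner_def (𝕜 := ℂ) φ φ)
    rw [inner_self_eq_norm_sq_to_K] at this
    simp only [inner_self_eq_norm_sq_to_K] at this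
    have e : (∫ a, ((‖(φ : X → ℂ) a‖ : ℂ)) ^ 2 ∂μ) = ((∫ a, ‖(φ : X → ℂ) a‖ ^ 2 ∂μ : ℝ) : ℂ) := by
      rw [← integral_complex_ofReal]; simp
    have this2 : ((‖φ‖ : ℂ) ^ 2).re = (∫ a, ((‖(φ : X → ℂ) a‖ : ℂ)) ^ 2 ∂μ).re := this
    rw [e] at this2
    exact_mod_cast this2
  have hcont : ∀ u : X → ℝ, Continuous u →
      Continuous fun x => (n : ℝ)⁻¹ * ∑ k ∈ Finset.range n, u ((⇑T.symm)^[k] x) := fun u hu =>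
    continuous_const.mul (continuous_finset_sum _ fun k _ => hu.comp (hSc.iterate k))
  have hmul : ∀ u : X → ℝ, Continuous u → Integrable (fun x => u x * ‖(φ : X → ℂ) x‖ ^ 2) μ := by
    intro u hu
    obtain ⟨C, hC⟩ := (isCompact_univ (X := X)).exists_bound_of_continuousOn hu.continuousOn
    exact hφ.bdd_mul hu.aestronglyMeasurable (Eventually.of_forall fun x => hC x (Set.mem_univ x))
  have hchg : (∫ x, ((n : ℝ)⁻¹ * ∑ k ∈ Finset.range n, g ((⇑T.symm)^[k] x))
            * ‖(φ : X → ℂ) (T x)‖ ^ 2 ∂μ) =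
      ∫ x, ((n : ℝ)⁻¹ * ∑ k ∈ Finset.range n, g (T.symm ((⇑T.symm)^[k] x)))
            * ‖(φ : X → ℂ) x‖ ^ 2 ∂μ := by
    rw [← hT.integral_comp T.toMeasurableEquiv.measurableEmbedding
      (fun x => ((n : ℝ)⁻¹ * ∑ k ∈ Finset.range n, g (T.symm ((⇑T.symm)^[k] x)))
            * ‖(φ : X → ℂ) x‖ ^ 2)]
    refine integral_congr_ae (Eventually.of_forall fun x => ?_)
    simp only [← Function.iterate_succ_apply' (⇑T.symm), Function.iterate_succ_apply,
      Homeomorph.symm_apply_apply]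
  rw [hchg, ← integral_add (hmul _ (hcont f hf)) (hmul _ (hcont (fun y => g (T.symm y)) (hg.comp hSc))),
    hnorm, ← integral_const_mul]
  refine integral_mono (hφ.const_mul _) ((hmul _ (hcont f hf)).add
    (hmul _ (hcont (fun y => g (T.symm y)) (hg.comp hSc)))) fun x => ?_
  have := hk n hn x
  rw [Finset.sum_add_distrib, mul_add] at this
  have := mul_le_mul_of_nonneg_right this (sq_nonneg ‖(φ : X → ℂ) x‖)
  simp only [Pi.add_apply]
  linarith
end

section
/- Let X be a topological space, let φ : ℝ × X → X be a continuous flow on X (φ(0,·) = id and φ(s+t,·) = φ(s, φ(t,·))), let u : X → ℝ be continuous with u∘φ(−·, q) locally integrable in the time variable for each q, and let L > 0. Define u_L(q) := (1/L) ∫₀^L u(φ(−t, q)) dt and ũ_L(q) := (1/L) ∫₀^L ( ∫₀^t u(φ(−s, q)) ds ) dt. Then for every p ∈ X, the function τ ↦ ũ_L(φ(τ, p)) is differentiable at τ = 0 with derivative u(p) − u_L(p). -/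
open MeasureTheory

/-- Let `φ` be a continuous flow on a topological space `X`, `u : X → ℝ`
continuous with locally integrable time samplings, and `L > 0`. With
`u_L(q) := (1/L) ∫₀^L u(φ(-t,q)) dt` and `ũ_L(q) := (1/L) ∫₀^L ∫₀^t u(φ(-s,q)) ds dt`,
for every `p ∈ X` the map `τ ↦ ũ_L(φ(τ,p))` is differentiable at `τ = 0` with derivative
`u(p) - u_L(p)`. -/
theorem stmt8 {X : Type*} [TopologicalSpace X]
    (φ : ℝ → X → X) (hφ : Continuous fun p : ℝ × X => φ p.1 p.2)
    (h0 : ∀ x, φ 0 x = x) (hadd : ∀ s t x, φ (s + t) x = φ s (φ t x))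
    (u : X → ℝ) (hu : Continuous u)
    (hloc : ∀ q, LocallyIntegrable (fun t : ℝ => u (φ (-t) q)) volume)
    (L : ℝ) (hL : 0 < L) (p : X) :
    HasDerivAt
      (fun τ : ℝ => L⁻¹ * ∫ t in (0:ℝ)..L, ∫ s in (0:ℝ)..t, u (φ (-s) (φ τ p)))
      (u p - L⁻¹ * ∫ t in (0:ℝ)..L, u (φ (-t) p)) 0 := by
  obtain ⟨w, hw⟩ : ∃ w : ℝ → ℝ, w = fun s => u (φ (-s) p) := ⟨_, rfl⟩
  have hwc : Continuous w := by
    rw [hw]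
    exact hu.comp (hφ.comp (continuous_neg.prodMk continuous_const))
  obtain ⟨W, hW⟩ : ∃ W : ℝ → ℝ, W = fun x => ∫ s in (0:ℝ)..x, w s := ⟨_, rfl⟩
  have hWd : ∀ x, HasDerivAt W (w x) x := by
    intro x
    rw [hW]
    exact hwc.integral_hasStrictDerivAt 0 x |>.hasDerivAt
  have hWc : Continuous W := continuous_iff_continuousAt.2 fun x => (hWd x).continuousAt
  obtain ⟨V, hV⟩ : ∃ V : ℝ → ℝ, V = fun x => ∫ s in (0:ℝ)..x, W s := ⟨_, rfl⟩
  have hVd : ∀ x, HasDerivAt V (W x) x := by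
    intro x
    rw [hV]
    exact hWc.integral_hasStrictDerivAt 0 x |>.hasDerivAt
  have key : (fun τ : ℝ => L⁻¹ * ∫ t in (0:ℝ)..L, ∫ s in (0:ℝ)..t, u (φ (-s) (φ τ p)))
      = fun τ => L⁻¹ * (V (L - τ) - V (0 - τ) - L * W (0 - τ)) := by
    funext τ
    have h1 : ∀ t : ℝ, ∫ s in (0:ℝ)..t, u (φ (-s) (φ τ p)) = W (t - τ) - W (0 - τ) := by
      intro t
      have h2 : ∀ s, u (φ (-s) (φ τ p)) = w (s - τ) := by
        intro s
        rw [hw, ← hadd]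
        simp only
        congr 2
        ring
      simp only [h2]
      rw [intervalIntegral.integral_comp_sub_right, hW]
      exact (intervalIntegral.integral_interval_sub_left
        (hwc.intervalIntegrable _ _) (hwc.intervalIntegrable _ _)).symm
    simp only [h1]
    have hi : IntervalIntegrable (fun t => W (t - τ)) volume 0 L :=
      (hWc.comp (continuous_sub_right τ)).intervalIntegrable _ _
    rw [intervalIntegral.integral_sub hi
      intervalIntegrable_const, intervalIntegral.integral_comp_sub_right,
      intervalIntegral.integral_const, hV]
    simp only
    rw [intervalIntegral.integral_interval_sub_left
        (hWc.intervalIntegrable _ _) (hWc.intervalIntegrable _ _)]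
    simp
  rw [key]
  have hs : ∀ c : ℝ, HasDerivAt (fun τ : ℝ => c - τ) (-1) 0 := fun c =>
    (hasDerivAt_id (0:ℝ)).const_sub c
  have d1 := (hVd (L - 0)).comp (0:ℝ) (hs L)
  have d2 := (hVd (0 - 0)).comp (0:ℝ) (hs 0)
  have d3 := (hWd (0 - 0)).comp (0:ℝ) (hs 0)
  have d := ((d1.sub d2).sub (d3.const_mul L)).const_mul L⁻¹
  refine d.congr_deriv ?_
  have e1 : W 0 = 0 := by rw [hW]; simp
  have e2 : w 0 = u p := by rw [hw]; simp [h0]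
  have e3 : ∫ t in (0:ℝ)..L, u (φ (-t) p) = W L := by rw [hW, hw]
  rw [e3]
  simp only [sub_zero, e1, e2]
  field_simp
  ring
end

section
/- Let 𝕋 := ℝ/ℤ with its Haar probability measure, and for t ∈ ℝ let V_t be the unitary Koopman operator on L²(𝕋) given by (V_t φ)(x) = φ(x + t), where x + t is taken mod ℤ. Let u, w : 𝕋 → ℂ be continuous functions such that for every x ∈ 𝕋 the map t ↦ u(x + t) is differentiable with derivative w(x + t). Then: (i) for every t ∈ ℝ, V_t M_u V_{−t} = M_{u_t}, where u_t(x) := u(x+t) and M_h denotes the multiplication operator by h on L²(𝕋); and (ii) the map ℝ → B(L²(𝕋)), t ↦ V_t M_u V_{−t}, is differentiable in operator norm, with derivative at t equal to M_{w_t}, where w_t(x) := w(x+t). -/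
open MeasureTheory

/-- Let `𝕋 := ℝ/ℤ` with Haar probability measure, `V_t` the Koopman unitary
of translation by `t` on `L²(𝕋)` (characterized by `(V_t φ)(x) = φ(x + t)` a.e.), and `M_h`
the multiplication operator by a continuous `h` (characterized by `(M_h φ)(x) = h(x) φ(x)`
a.e.). If `u, w : 𝕋 → ℂ` are continuous with `t ↦ u(x+t)` differentiable with derivative
`w(x+t)` for each `x`, then (i) `V_t M_u V_{-t} = M_{u(·+t)}` for every `t`, and (ii) the map
`t ↦ V_t M_u V_{-t}` is norm-differentiable with derivative `M_{w(·+t)}` at every `t`. -/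
theorem stmt11
    (V : ℝ → (Lp ℂ 2 (volume : Measure (AddCircle (1:ℝ))) →L[ℂ]
      Lp ℂ 2 (volume : Measure (AddCircle (1:ℝ)))))
    (hV : ∀ (t : ℝ) (φ : Lp ℂ 2 (volume : Measure (AddCircle (1:ℝ)))),
      (V t φ : AddCircle (1:ℝ) → ℂ) =ᵐ[volume] fun x => φ (x + (t : AddCircle (1:ℝ))))
    (M : C(AddCircle (1:ℝ), ℂ) → (Lp ℂ 2 (volume : Measure (AddCircle (1:ℝ))) →L[ℂ]
      Lp ℂ 2 (volume : Measure (AddCircle (1:ℝ)))))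
    (hM : ∀ (h : C(AddCircle (1:ℝ), ℂ)) (φ : Lp ℂ 2 (volume : Measure (AddCircle (1:ℝ)))),
      (M h φ : AddCircle (1:ℝ) → ℂ) =ᵐ[volume] fun x => h x * φ x)
    (u w : C(AddCircle (1:ℝ), ℂ))
    (huw : ∀ (x : AddCircle (1:ℝ)) (t : ℝ),
      HasDerivAt (fun s : ℝ => u (x + (s : AddCircle (1:ℝ))))
        (w (x + (t : AddCircle (1:ℝ)))) t) :
    (∀ t : ℝ, (V t).comp ((M u).comp (V (-t)))
        = M (u.comp ⟨fun x => x + (t : AddCircle (1:ℝ)), by continuity⟩)) ∧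
    (∀ t : ℝ, HasDerivAt (fun s : ℝ => (V s).comp ((M u).comp (V (-s))))
        (M (w.comp ⟨fun x => x + (t : AddCircle (1:ℝ)), by continuity⟩)) t) := by
  have h1 : ∀ t : ℝ, (V t).comp ((M u).comp (V (-t)))
        = M (u.comp ⟨fun x => x + (t : AddCircle (1:ℝ)), by continuity⟩) := by
    intro t
    ext1 φ
    apply Lp.ext
    have hq : Measure.QuasiMeasurePreserving (fun x : AddCircle (1:ℝ) => x + (t : AddCircle (1:ℝ)))
        volume volume :=
      (measurePreserving_add_right volume (t : AddCircle (1:ℝ))).quasiMeasurePreserving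
    filter_upwards [hV t (M u (V (-t) φ)), hq.ae (hM u (V (-t) φ)), hq.ae (hV (-t) φ),
      hM (u.comp ⟨fun x => x + (t : AddCircle (1:ℝ)), by continuity⟩) φ] with x a b c d
    simp only [ContinuousLinearMap.comp_apply]
    rw [a, b, c, d]
    simp
  refine ⟨h1, fun t => ?_⟩
  simp_rw [h1]
  rw [hasDerivAt_iff_isLittleO, Asymptotics.isLittleO_iff]
  intro ε hε
  have huc : UniformContinuous w := CompactSpace.uniformContinuous_of_continuous w.continuous
  obtain ⟨δ, hδ, hw⟩ := Metric.uniformContinuous_iff.1 huc ε hε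
  filter_upwards [Metric.ball_mem_nhds t hδ] with s hs
  refine ContinuousLinearMap.opNorm_le_bound _ (by positivity) fun φ => ?_
  have key : ∀ x : AddCircle (1:ℝ), ‖u (x + (s : AddCircle (1:ℝ))) - u (x + (t : AddCircle (1:ℝ)))
      - (s - t : ℝ) • w (x + (t : AddCircle (1:ℝ)))‖ ≤ ε * ‖s - t‖ := by
    intro x
    have := (convex_ball t δ).norm_image_sub_le_of_norm_hasDerivWithin_le
      (f := fun r : ℝ => u (x + (r : AddCircle (1:ℝ))) - r • w (x + (t : AddCircle (1:ℝ))))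
      (f' := fun r : ℝ => w (x + (r : AddCircle (1:ℝ))) - (1:ℝ) • w (x + (t : AddCircle (1:ℝ))))
      (C := ε) (fun r _ => ((huw x r).sub ((hasDerivAt_id r).smul_const _)).hasDerivWithinAt)
      (fun r hr => ?_) (Metric.mem_ball_self hδ) hs
    · refine le_of_eq_of_le (congrArg _ ?_) this
      rw [sub_smul]; abel
    · rw [one_smul, ← dist_eq_norm]
      refine (hw ?_).le
      rw [dist_add_left, dist_eq_norm, ← AddCircle.coe_sub]
      refine lt_of_le_of_lt QuotientAddGroup.norm_mk_le_norm ?_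
      rwa [← dist_eq_norm]
  apply Lp.norm_le_mul_norm_of_ae_le_mul
  simp only [sub_apply, smul_apply]
  filter_upwards [Lp.coeFn_sub (M (u.comp ⟨fun x => x + (s : AddCircle (1:ℝ)), by continuity⟩) φ
      - M (u.comp ⟨fun x => x + (t : AddCircle (1:ℝ)), by continuity⟩) φ)
      ((s - t) • M (w.comp ⟨fun x => x + (t : AddCircle (1:ℝ)), by continuity⟩) φ),
    Lp.coeFn_sub (M (u.comp ⟨fun x => x + (s : AddCircle (1:ℝ)), by continuity⟩) φ)
      (M (u.comp ⟨fun x => x + (t : AddCircle (1:ℝ)), by continuity⟩) φ),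
    Lp.coeFn_smul (s - t) (M (w.comp ⟨fun x => x + (t : AddCircle (1:ℝ)), by continuity⟩) φ),
    hM (u.comp ⟨fun x => x + (s : AddCircle (1:ℝ)), by continuity⟩) φ,
    hM (u.comp ⟨fun x => x + (t : AddCircle (1:ℝ)), by continuity⟩) φ,
    hM (w.comp ⟨fun x => x + (t : AddCircle (1:ℝ)), by continuity⟩) φ] with x a b c d e f
  rw [a, Pi.sub_apply, b, Pi.sub_apply, c, Pi.smul_apply, d, e, f]
  simp only [ContinuousMap.comp_apply, ContinuousMap.coe_mk]
  rw [← smul_mul_assoc, ← sub_mul, ← sub_mul, norm_mul]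
  exact mul_le_mul_of_nonneg_right (key x) (norm_nonneg _)
end
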